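/- (Boson–Fermion correspondence, affine gl_r relations.) For i, j ∈ [r] and a ∈ ℤ, define the normally ordered product :Q_{m,i}P_{n,j}: := Q_{m,i}∘P_{n,j} if n > 0 and := −P_{n,j}∘Q_{m,i} if n ≤ 0. Then: (a) for every r-Maya diagram 𝔪, only finitely many of the operators :Q_{m,i}P_{m+a,j}: (m ∈ ℤ) are nonzero on v_𝔪, so e_{ij}^a := Σ_{m∈ℤ} :Q_{m,i}P_{m+a,j}: is a well-defined additive endomorphism of 𝔉(r); (b) each e_{ij}^a preserves every central-charge component ⊕_{n∈ℤ} 𝔉(r)_{l,n}; and (c) for all i, j, k, l ∈ [r] and a, b ∈ ℤ, the commutator satisfies e_{ij}^a∘e_{kl}^b − e_{kl}^b∘e_{ij}^a = δ_{jk}·e_{il}^{a+b} − δ_{il}·e_{kj}^{a+b} + a·δ_{il}δ_{jk}δ_{a,−b}·id_{𝔉(r)}. -/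

import Mathlib

/-- An `r`-Maya diagram: a function `ℤ → Finset (Fin r)` which is eventually the full set
`[r]` in the negative direction and eventually empty in the positive direction. -/
structure MayaDiagram (r : ℕ) where
  idx : ℤ → Finset (Fin r)
  eventually_full : ∃ N : ℤ, ∀ a : ℤ, a < N → idx a = Finset.univ
  eventually_empty : ∃ N : ℤ, ∀ a : ℤ, N < a → idx a = ∅

namespace MayaDiagram

variable {r : ℕ}

/-- Replace the value of a Maya diagram at `a` by `J`. -/
def update (m : MayaDiagram r) (a : ℤ) (J : Finset (Fin r)) : MayaDiagram r where
  idx := Function.update m.idx a J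
  eventually_full := by
    obtain ⟨N, hN⟩ := m.eventually_full
    refine ⟨min N a, fun b hb => ?_⟩
    rw [Function.update_of_ne (show b ≠ a by omega)]
    exact hN b (by omega)
  eventually_empty := by
    obtain ⟨N, hN⟩ := m.eventually_empty
    refine ⟨max N a, fun b hb => ?_⟩
    rw [Function.update_of_ne (show b ≠ a by omega)]
    exact hN b (by omega)

/-- The shifted Maya diagram `m⁻`, with `(m⁻)_a := I_{a+1}`. -/
def shiftDown (m : MayaDiagram r) : MayaDiagram r where
  idx := fun a => m.idx (a + 1)
  eventually_full := by
    obtain ⟨N, hN⟩ := m.eventually_full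
    exact ⟨N - 1, fun b hb => hN _ (by omega)⟩
  eventually_empty := by
    obtain ⟨N, hN⟩ := m.eventually_empty
    exact ⟨N, fun b hb => hN _ (by omega)⟩

/-- The shifted Maya diagram `m⁺`, with `(m⁺)_a := I_{a-1}`. -/
def shiftUp (m : MayaDiagram r) : MayaDiagram r where
  idx := fun a => m.idx (a - 1)
  eventually_full := by
    obtain ⟨N, hN⟩ := m.eventually_full
    exact ⟨N, fun b hb => hN _ (by omega)⟩
  eventually_empty := by
    obtain ⟨N, hN⟩ := m.eventually_empty
    exact ⟨N + 1, fun b hb => hN _ (by omega)⟩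

/-- `Σ_{k > a} |I_k|` (a finite sum). -/
noncomputable def tailCard (m : MayaDiagram r) (a : ℤ) : ℕ :=
  ∑ᶠ k ∈ {k : ℤ | a < k}, (m.idx k).card

/-- The central charge `c_m := Σ_{a>0} |I_a| − Σ_{a≤0} (r − |I_a|)`. -/
noncomputable def charge (m : MayaDiagram r) : ℤ :=
  (∑ᶠ a ∈ {a : ℤ | 0 < a}, ((m.idx a).card : ℤ)) -
    ∑ᶠ a ∈ {a : ℤ | a ≤ 0}, ((r : ℤ) - (m.idx a).card)

/-- The weight `w_m := Σ_{a>0} a·|I_a| − Σ_{a≤0} a·(r − |I_a|)`. -/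
noncomputable def weight (m : MayaDiagram r) : ℤ :=
  (∑ᶠ a ∈ {a : ℤ | 0 < a}, a * ((m.idx a).card : ℤ)) -
    ∑ᶠ a ∈ {a : ℤ | a ≤ 0}, a * ((r : ℤ) - (m.idx a).card)

end MayaDiagram

/-- The Fermionic Fock space `𝔉(r)`: the free ℤ-module on the `r`-Maya diagrams. -/
abbrev Fock (r : ℕ) := MayaDiagram r →₀ ℤ

/-- `#{j ∈ I : j < i}`. -/
def signCount {r : ℕ} (I : Finset (Fin r)) (i : Fin r) : ℕ :=
  (I.filter (fun j => j < i)).card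

/-- The operator `P_{a,i}` on the Fock space. -/
noncomputable def PF {r : ℕ} (a : ℤ) (i : Fin r) : Module.End ℤ (Fock r) :=
  Finsupp.lift (Fock r) ℤ (MayaDiagram r) fun m =>
    if i ∈ m.idx a then
      ((-1 : ℤ) ^ (m.tailCard a + signCount (m.idx a) i)) •
        Finsupp.single (m.update a ((m.idx a).erase i)) 1
    else 0

/-- The operator `Q_{a,i}` on the Fock space. -/
noncomputable def QF {r : ℕ} (a : ℤ) (i : Fin r) : Module.End ℤ (Fock r) :=
  Finsupp.lift (Fock r) ℤ (MayaDiagram r) fun m =>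
    if i ∈ m.idx a then 0
    else
      ((-1 : ℤ) ^ (m.tailCard a + signCount (m.idx a) i)) •
        Finsupp.single (m.update a (insert i (m.idx a))) 1

/-- The shift operator `E` on the Fock space, `E·v_m := v_{m⁻}`. -/
noncomputable def EF {r : ℕ} : Module.End ℤ (Fock r) :=
  Finsupp.lmapDomain ℤ ℤ MayaDiagram.shiftDown

/-- The shift operator `F` on the Fock space, `F·v_m := v_{m⁺}`. -/
noncomputable def FF {r : ℕ} : Module.End ℤ (Fock r) :=
  Finsupp.lmapDomain ℤ ℤ MayaDiagram.shiftUp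

/-- The component `𝔉(r)_{l,n}` of the Fock space spanned by basis vectors of central
charge `l` and weight `n`. -/
noncomputable def FockComp (r : ℕ) (l n : ℤ) : Submodule ℤ (Fock r) :=
  Submodule.span ℤ
    {x | ∃ m : MayaDiagram r, m.charge = l ∧ m.weight = n ∧ x = Finsupp.single m 1}

/-- The central-charge component `𝔉(r)_{l,•}`: the span of the basis vectors of central
charge `l`. -/
noncomputable def FockCharge (r : ℕ) (l : ℤ) : Submodule ℤ (Fock r) :=
  Submodule.span ℤ {x | ∃ m : MayaDiagram r, m.charge = l ∧ x = Finsupp.single m 1}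

/-- The normally ordered product `:Q_{m,i}P_{n,j}:`. -/
noncomputable def NO {r : ℕ} (m : ℤ) (i : Fin r) (n : ℤ) (j : Fin r) :
    Module.End ℤ (Fock r) :=
  if 0 < n then QF m i * PF n j else -(PF n j * QF m i)

/-- The operator `e_{ij}^a := Σ_{m ∈ ℤ} :Q_{m,i}P_{m+a,j}:` on the Fock space, defined
on each basis vector by the (pointwise finite) sum `Σᶠ_m :Q_{m,i}P_{m+a,j}: v_𝔪`. -/
noncomputable def affineE {r : ℕ} (i j : Fin r) (a : ℤ) : Module.End ℤ (Fock r) :=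
  Finsupp.lift (Fock r) ℤ (MayaDiagram r) fun m =>
    ∑ᶠ k : ℤ, NO k i (k + a) j (Finsupp.single m 1)

theorem finsum_add_eq_of_eq_off {α M : Type*} [AddCommMonoid M] {f g : α → M}
    (hf : f.support.Finite) (hg : g.support.Finite) (a : α) (c d : M)
    (hoff : ∀ b, b ≠ a → f b = g b) (ha : f a + c = g a + d) :
    ∑ᶠ x, f x + c = ∑ᶠ x, g x + d := by
  classical
  have hsingle : ∀ e : M, ∑ᶠ x, (Pi.single a e : α → M) x = e := fun e => by
    rw [finsum_eq_single _ a fun x hx => Pi.single_eq_of_ne hx _, Pi.single_eq_same]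
  have hfin : ∀ e : M, (Function.support (Pi.single a e : α → M)).Finite := fun e =>
    (Set.finite_singleton a).subset Pi.support_single_subset
  conv_lhs => rw [← hsingle c]
  conv_rhs => rw [← hsingle d]
  rw [← finsum_add_distrib hf (hfin _), ← finsum_add_distrib hg (hfin _)]
  refine finsum_congr fun x => ?_
  by_cases hx : x = a
  · subst hx; simpa using ha
  · simp [hx, hoff x hx]

namespace MayaDiagram

variable {r : ℕ}

theorem ext_idx {m n : MayaDiagram r} (h : m.idx = n.idx) : m = n := by
  cases m; cases n; cases h; rfl

/-- Flip whether `i` belongs to `I_a`. -/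
def toggle (m : MayaDiagram r) (a : ℤ) (i : Fin r) : MayaDiagram r :=
  m.update a (symmDiff (m.idx a) {i})

theorem update_idx_same (m : MayaDiagram r) (a : ℤ) (J : Finset (Fin r)) :
    (m.update a J).idx a = J :=
  Function.update_self ..

theorem toggle_idx_same (m : MayaDiagram r) (a : ℤ) (i : Fin r) :
    (m.toggle a i).idx a = symmDiff (m.idx a) {i} :=
  m.update_idx_same a _

theorem toggle_idx_of_ne (m : MayaDiagram r) {a b : ℤ} (i : Fin r) (h : b ≠ a) :
    (m.toggle a i).idx b = m.idx b :=
  Function.update_of_ne h ..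

theorem mem_toggle (m : MayaDiagram r) (a b : ℤ) (i j : Fin r) :
    j ∈ (m.toggle a i).idx b ↔
      if b = a ∧ j = i then j ∉ m.idx b else j ∈ m.idx b := by
  by_cases hb : b = a
  · subst hb
    rw [toggle_idx_same, Finset.mem_symmDiff, Finset.mem_singleton]
    by_cases hj : j = i <;> simp [hj]
  · simp [toggle_idx_of_ne m i hb, hb]

theorem toggle_comm (m : MayaDiagram r) (a b : ℤ) (i j : Fin r) :
    (m.toggle a i).toggle b j = (m.toggle b j).toggle a i := by
  refine ext_idx (funext fun c => Finset.ext fun k => ?_)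
  simp only [mem_toggle]
  grind

theorem toggle_toggle (m : MayaDiagram r) (a : ℤ) (i : Fin r) :
    (m.toggle a i).toggle a i = m := by
  refine ext_idx (funext fun c => Finset.ext fun k => ?_)
  simp only [mem_toggle]
  grind

theorem update_erase (m : MayaDiagram r) {a : ℤ} {i : Fin r} (h : i ∈ m.idx a) :
    m.update a ((m.idx a).erase i) = m.toggle a i := by
  unfold toggle
  congr 1
  ext k
  simp only [Finset.mem_erase, Finset.mem_symmDiff, Finset.mem_singleton]
  grind

theorem update_insert (m : MayaDiagram r) {a : ℤ} {i : Fin r} (h : i ∉ m.idx a) :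
    m.update a (insert i (m.idx a)) = m.toggle a i := by
  unfold toggle
  congr 1
  ext k
  simp only [Finset.mem_insert, Finset.mem_symmDiff, Finset.mem_singleton]
  grind

theorem card_toggle (m : MayaDiagram r) (a : ℤ) (i : Fin r) :
    (((m.toggle a i).idx a).card : ℤ) =
      (m.idx a).card + if i ∈ m.idx a then -1 else 1 := by
  split_ifs with h
  · rw [← update_erase m h, update_idx_same, Finset.card_erase_of_mem h,
      Nat.cast_sub (Finset.card_pos.2 ⟨i, h⟩)]
    simp [sub_eq_add_neg]
  · rw [← update_insert m h, update_idx_same, Finset.card_insert_of_notMem h]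
    simp

theorem finite_support_Ioi {M : Type*} [AddMonoidWithOne M] (m : MayaDiagram r) (a : ℤ) :
    (Function.support (Set.indicator {k : ℤ | a < k} fun k => ((m.idx k).card : M))).Finite := by
  obtain ⟨N, hN⟩ := m.eventually_empty
  refine (Set.finite_Ioc a N).subset fun k hk => ?_
  rw [Function.mem_support] at hk
  by_contra hk'
  refine hk ?_
  rw [Set.indicator_apply]
  split_ifs with h
  · rw [hN k (by simp only [Set.mem_Ioc, Set.mem_ofPred_eq] at hk' h; omega)]
    simp
  · rfl

theorem finite_support_Iic (m : MayaDiagram r) (a : ℤ) :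
    (Function.support
      (Set.indicator {k : ℤ | k ≤ a} fun k => ((r : ℤ) - (m.idx k).card))).Finite := by
  obtain ⟨N, hN⟩ := m.eventually_full
  refine (Set.finite_Icc N a).subset fun k hk => ?_
  rw [Function.mem_support] at hk
  by_contra hk'
  refine hk ?_
  rw [Set.indicator_apply]
  split_ifs with h
  · rw [hN k (by simp only [Set.mem_Icc, Set.mem_ofPred_eq] at hk' h; omega)]
    simp
  · rfl

theorem charge_toggle (m : MayaDiagram r) (a : ℤ) (i : Fin r) :
    (m.toggle a i).charge = m.charge + if i ∈ m.idx a then -1 else 1 := by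
  have hcard := card_toggle m a i
  set e : ℤ := if i ∈ m.idx a then -1 else 1
  unfold charge
  simp only [finsum_mem_def]
  have h₁ := finsum_add_eq_of_eq_off (finite_support_Ioi (M := ℤ) (m.toggle a i) 0)
    (finite_support_Ioi m 0) a 0 (if 0 < a then e else 0)
    (fun b hb => by simp only [Set.indicator_apply, toggle_idx_of_ne m i hb])
    (by simp only [Set.indicator_apply, Set.mem_ofPred_eq, hcard]; split_ifs <;> ring)
  have h₂ := finsum_add_eq_of_eq_off (finite_support_Iic (m.toggle a i) 0)
    (finite_support_Iic m 0) a 0 (if 0 < a then 0 else -e)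
    (fun b hb => by simp only [Set.indicator_apply, toggle_idx_of_ne m i hb])
    (by simp only [Set.indicator_apply, Set.mem_ofPred_eq, hcard, ← not_lt]
        split_ifs <;> first | contradiction | ring)
  split_ifs at h₁ h₂ <;> linarith

theorem tailCard_toggle (m : MayaDiagram r) (a b : ℤ) (i : Fin r) :
    (-1 : ℤ) ^ (m.toggle a i).tailCard b =
      (if b < a then -1 else 1) * (-1) ^ m.tailCard b := by
  have hcard := card_toggle m a i
  have h := fun c d => finsum_add_eq_of_eq_off
    (finite_support_Ioi (M := ℕ) (m.toggle a i) b) (finite_support_Ioi m b) a c d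
    (fun b hb => by simp only [Set.indicator_apply, toggle_idx_of_ne m i hb])
  unfold tailCard
  simp only [finsum_mem_def]
  simp only [Nat.cast_id, Set.indicator_apply, Set.mem_ofPred_eq] at h ⊢
  by_cases hb : b < a
  · simp only [hb, if_true] at h ⊢
    split_ifs at hcard with hi
    · rw [← add_zero (∑ᶠ x, if b < x then (m.idx x).card else 0), ← h 1 0 (by omega)]
      ring
    · rw [← add_zero (∑ᶠ x, if b < x then ((m.toggle a i).idx x).card else 0),
        h 0 1 (by omega)]
      ring
  · simp only [hb, if_false] at h ⊢
    have := h 0 0 rfl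
    simp only [add_zero] at this
    rw [this, one_mul]

theorem signCount_toggle (m : MayaDiagram r) (a b : ℤ) (i j : Fin r) :
    (-1 : ℤ) ^ signCount ((m.toggle a i).idx b) j =
      (if b = a ∧ i < j then -1 else 1) * (-1) ^ signCount (m.idx b) j := by
  by_cases hb : b = a
  · subst hb
    unfold signCount
    by_cases hi : i ∈ m.idx b
    · rw [← update_erase m hi, update_idx_same, Finset.filter_erase]
      by_cases hij : i < j
      · rw [← Finset.card_erase_add_one (Finset.mem_filter.2 ⟨hi, hij⟩)]
        simp [hij, pow_succ]
      · rw [Finset.erase_eq_of_notMem (by simp [hij])]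
        simp [hij]
    · rw [← update_insert m hi, update_idx_same, Finset.filter_insert]
      by_cases hij : i < j
      · rw [if_pos hij, Finset.card_insert_of_notMem (by simp [hi])]
        simp [hij, pow_succ]
      · simp [hij]
  · simp [toggle_idx_of_ne m i hb, hb]

/-- The sign with which `P_{a,i}` and `Q_{a,i}` act on `v_m`. -/
noncomputable def sgn (m : MayaDiagram r) (a : ℤ) (i : Fin r) : ℤ :=
  (-1) ^ (m.tailCard a + signCount (m.idx a) i)

theorem sgn_toggle (m : MayaDiagram r) (a b : ℤ) (i j : Fin r) :
    (m.toggle a i).sgn b j =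
      (if b < a ∨ b = a ∧ i < j then -1 else 1) * m.sgn b j := by
  unfold sgn
  rw [pow_add, pow_add, tailCard_toggle, signCount_toggle]
  by_cases h₁ : b < a <;> by_cases h₂ : b = a ∧ i < j
  · omega
  all_goals simp [h₁, h₂]

theorem sgn_mul_self (m : MayaDiagram r) (a : ℤ) (i : Fin r) : m.sgn a i * m.sgn a i = 1 := by
  unfold sgn
  rw [← mul_pow]
  simp

/-- Flipping two different slots in the two possible orders produces opposite signs. -/
theorem sgn_toggle_swap (m : MayaDiagram r) {a b : ℤ} {i j : Fin r} (h : ¬(a = b ∧ i = j)) :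
    m.sgn a i * (m.toggle a i).sgn b j = -(m.sgn b j * (m.toggle b j).sgn a i) := by
  rw [sgn_toggle, sgn_toggle]
  by_cases h₁ : b < a ∨ b = a ∧ i < j
  · have h₂ : ¬(a < b ∨ a = b ∧ j < i) := by omega
    simp only [h₁, h₂, if_true, if_false]
    ring
  · have h₂ : a < b ∨ a = b ∧ j < i := by omega
    simp only [h₁, h₂, if_true, if_false]
    ring

end MayaDiagram

open MayaDiagram in
theorem PF_single {r : ℕ} (a : ℤ) (i : Fin r) (m : MayaDiagram r) :
    PF a i (Finsupp.single m 1) =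
      if i ∈ m.idx a then m.sgn a i • Finsupp.single (m.toggle a i) 1 else 0 := by
  simp only [PF, Finsupp.lift_apply, Finsupp.sum_single_index, zero_smul, one_smul]
  split_ifs with h
  · rw [update_erase m h, sgn]
  · rfl

open MayaDiagram in
theorem QF_single {r : ℕ} (a : ℤ) (i : Fin r) (m : MayaDiagram r) :
    QF a i (Finsupp.single m 1) =
      if i ∈ m.idx a then 0 else m.sgn a i • Finsupp.single (m.toggle a i) 1 := by
  simp only [QF, Finsupp.lift_apply, Finsupp.sum_single_index, zero_smul, one_smul]
  split_ifs with h
  · rfl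
  · rw [update_insert m h, sgn]

theorem Fock.end_ext {r : ℕ} {f g : Module.End ℤ (Fock r)}
    (h : ∀ m, f (Finsupp.single m 1) = g (Finsupp.single m 1)) : f = g :=
  Finsupp.lhom_ext' fun m => LinearMap.ext_ring (h m)

section Anticommutators

variable {r : ℕ} (a b : ℤ) (i j : Fin r)

theorem PF_mul_PF : PF a i * PF b j = -(PF b j * PF a i) := by
  refine Fock.end_ext fun m => ?_
  simp only [Module.End.mul_apply, LinearMap.neg_apply, PF_single]
  by_cases h : a = b ∧ i = j
  · obtain ⟨rfl, rfl⟩ := h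
    split_ifs with hi <;> simp [-Finsupp.smul_single, PF_single, MayaDiagram.mem_toggle, hi]
  · have h' : ¬(b = a ∧ j = i) := fun h₁ => h ⟨h₁.1.symm, h₁.2.symm⟩
    split_ifs with h₁ h₂ h₂ <;>
      simp [-Finsupp.smul_single, PF_single, MayaDiagram.mem_toggle, h, h', h₁, h₂, smul_smul,
        MayaDiagram.toggle_comm m a b i j, m.sgn_toggle_swap h]

theorem QF_mul_QF : QF a i * QF b j = -(QF b j * QF a i) := by
  refine Fock.end_ext fun m => ?_
  simp only [Module.End.mul_apply, LinearMap.neg_apply, QF_single]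
  by_cases h : a = b ∧ i = j
  · obtain ⟨rfl, rfl⟩ := h
    split_ifs with hi <;> simp [-Finsupp.smul_single, QF_single, MayaDiagram.mem_toggle, hi]
  · have h' : ¬(b = a ∧ j = i) := fun h₁ => h ⟨h₁.1.symm, h₁.2.symm⟩
    split_ifs with h₁ h₂ h₂ <;>
      simp [-Finsupp.smul_single, QF_single, MayaDiagram.mem_toggle, h, h', h₁, h₂, smul_smul,
        MayaDiagram.toggle_comm m a b i j, m.sgn_toggle_swap h]

theorem PF_mul_QF :
    PF a i * QF b j = (if a = b ∧ i = j then 1 else 0) - QF b j * PF a i := by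
  refine Fock.end_ext fun m => ?_
  by_cases h : a = b ∧ i = j
  · obtain ⟨rfl, rfl⟩ := h
    by_cases hi : i ∈ m.idx a <;>
      simp [-Finsupp.smul_single, PF_single, QF_single, MayaDiagram.mem_toggle, hi, smul_smul,
        MayaDiagram.toggle_toggle, MayaDiagram.sgn_toggle, m.sgn_mul_self]
  · have h' : ¬(b = a ∧ j = i) := fun h₁ => h ⟨h₁.1.symm, h₁.2.symm⟩
    by_cases h₁ : i ∈ m.idx a <;> by_cases h₂ : j ∈ m.idx b <;>
      simp [-Finsupp.smul_single, PF_single, QF_single, MayaDiagram.mem_toggle, h, h', h₁, h₂, smul_smul,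
        MayaDiagram.toggle_comm m a b i j, m.sgn_toggle_swap h]

/-- The normally ordered product differs from `Q P` by a scalar. -/
theorem QF_mul_PF :
    QF a i * PF b j = NO a i b j + if b ≤ 0 ∧ a = b ∧ i = j then 1 else 0 := by
  unfold NO
  by_cases hb : 0 < b
  · simp [hb, not_le.2 hb]
  · rw [if_neg hb, PF_mul_QF]
    by_cases h : a = b ∧ i = j
    · simp [h, not_lt.1 hb]
    · have h' : ¬(b = a ∧ j = i) := fun h₁ => h ⟨h₁.1.symm, h₁.2.symm⟩
      simp [h, h']

theorem NO_commutator_QF (n : ℤ) (k : Fin r) :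
    NO a i b j * QF n k - QF n k * NO a i b j = if b = n ∧ j = k then QF a i else 0 := by
  rw [← sub_eq_of_eq_add (QF_mul_PF a b i j)]
  have h₁ : QF a i * PF b j * QF n k =
      (if b = n ∧ j = k then QF a i else 0) + QF n k * (QF a i * PF b j) := by
    rw [mul_assoc, PF_mul_QF, mul_sub, ← mul_assoc, QF_mul_QF, neg_mul, sub_neg_eq_add,
      mul_assoc]
    split_ifs <;> simp
  rw [sub_mul, mul_sub, h₁]
  split_ifs <;> simp

theorem NO_commutator_PF (n : ℤ) (k : Fin r) :
    NO a i b j * PF n k - PF n k * NO a i b j = -if n = a ∧ k = i then PF b j else 0 := by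
  rw [← sub_eq_of_eq_add (QF_mul_PF a b i j)]
  have h₁ : PF n k * (QF a i * PF b j) =
      (if n = a ∧ k = i then PF b j else 0) + QF a i * PF b j * PF n k := by
    rw [← mul_assoc, PF_mul_QF, sub_mul, mul_assoc, PF_mul_PF, mul_neg, sub_neg_eq_add,
      mul_assoc]
    split_ifs <;> simp
  rw [sub_mul, mul_sub, h₁]
  split_ifs <;> simp

end Anticommutators

theorem finite_support_NO_single {r : ℕ} (i j : Fin r) (a : ℤ) (m : MayaDiagram r) :
    {k : ℤ | NO k i (k + a) j (Finsupp.single m 1) ≠ 0}.Finite := by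
  obtain ⟨N, hN⟩ := m.eventually_full
  obtain ⟨M, hM⟩ := m.eventually_empty
  refine (Set.finite_Icc (min N (-a)) (max 0 M - a)).subset fun k hk => ?_
  by_contra hk'
  refine hk ?_
  simp only [Set.mem_Icc, not_and_or, not_le] at hk'
  rcases hk' with h | h
  · rw [NO, if_neg (by omega)]
    simp [QF_single, hN k (by omega)]
  · rw [NO, if_pos (by omega)]
    simp [PF_single, hM (k + a) (by omega)]

theorem finite_support_NO {r : ℕ} (i j : Fin r) (a : ℤ) (x : Fock r) :
    (Function.support fun k : ℤ => NO k i (k + a) j x).Finite := by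
  induction x using Finsupp.induction_linear with
  | zero => simp
  | add x y hx hy =>
    simp only [map_add]
    exact (hx.union hy).subset (Function.support_add _ _)
  | single m c =>
    refine (finite_support_NO_single i j a m).subset fun k hk h => hk ?_
    simp only
    rw [← mul_one c, ← smul_eq_mul, ← Finsupp.smul_single, map_smul, h, smul_zero]

theorem affineE_single {r : ℕ} (i j : Fin r) (a : ℤ) (m : MayaDiagram r) :
    affineE i j a (Finsupp.single m 1) = ∑ᶠ k : ℤ, NO k i (k + a) j (Finsupp.single m 1) := by
  simp [affineE]

theorem affineE_apply {r : ℕ} (i j : Fin r) (a : ℤ) (x : Fock r) :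
    affineE i j a x = ∑ᶠ k : ℤ, NO k i (k + a) j x := by
  induction x using Finsupp.induction_linear with
  | zero => simp
  | add x y hx hy =>
    simp only [map_add, hx, hy]
    exact (finsum_add_distrib (finite_support_NO i j a x) (finite_support_NO i j a y)).symm
  | single m c =>
    rw [← mul_one c, ← smul_eq_mul, ← Finsupp.smul_single]
    simp only [map_smul]
    rw [affineE_single, smul_finsum' c (finite_support_NO_single i j a m)]

section Charge

variable {r : ℕ} {l : ℤ} {x : Fock r}

theorem single_mem_FockCharge (m : MayaDiagram r) :
    Finsupp.single m 1 ∈ FockCharge r m.charge :=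
  Submodule.subset_span ⟨m, rfl, rfl⟩

theorem map_mem_FockCharge {l' : ℤ} (f : Module.End ℤ (Fock r))
    (h : ∀ m : MayaDiagram r, m.charge = l → f (Finsupp.single m 1) ∈ FockCharge r l')
    (hx : x ∈ FockCharge r l) : f x ∈ FockCharge r l' := by
  have hle : FockCharge r l ≤ (FockCharge r l').comap f := by
    refine Submodule.span_le.2 ?_
    rintro _ ⟨m, hm, rfl⟩
    exact h m hm
  exact hle hx

theorem PF_mem_FockCharge (a : ℤ) (i : Fin r) (hx : x ∈ FockCharge r l) :
    PF a i x ∈ FockCharge r (l - 1) := by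
  refine map_mem_FockCharge _ (fun m hm => ?_) hx
  rw [PF_single]
  split_ifs with h
  · refine Submodule.smul_mem _ _ ?_
    have hc := m.charge_toggle a i
    rw [if_pos h, hm, ← sub_eq_add_neg] at hc
    exact hc ▸ single_mem_FockCharge _
  · exact Submodule.zero_mem _

theorem QF_mem_FockCharge (a : ℤ) (i : Fin r) (hx : x ∈ FockCharge r l) :
    QF a i x ∈ FockCharge r (l + 1) := by
  refine map_mem_FockCharge _ (fun m hm => ?_) hx
  rw [QF_single]
  split_ifs with h
  · exact Submodule.zero_mem _
  · refine Submodule.smul_mem _ _ ?_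
    have hc := m.charge_toggle a i
    rw [if_neg h, hm] at hc
    exact hc ▸ single_mem_FockCharge _

theorem NO_mem_FockCharge (a b : ℤ) (i j : Fin r) (hx : x ∈ FockCharge r l) :
    NO a i b j x ∈ FockCharge r l := by
  unfold NO
  split_ifs
  · simpa using QF_mem_FockCharge a i (PF_mem_FockCharge b j hx)
  · simpa using PF_mem_FockCharge b j (QF_mem_FockCharge a i hx)

theorem affineE_mem_FockCharge (i j : Fin r) (a : ℤ) (hx : x ∈ FockCharge r l) :
    affineE i j a x ∈ FockCharge r l := by
  rw [affineE_apply]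
  exact finsum_induction (· ∈ FockCharge r l) (Submodule.zero_mem _)
    (fun _ _ => Submodule.add_mem _) fun k => NO_mem_FockCharge k (k + a) i j hx

end Charge

section Commutators

variable {r : ℕ} (i j k l : Fin r) (a b n : ℤ)

theorem affineE_commutator_apply (f : Module.End ℤ (Fock r)) (x : Fock r) :
    (affineE i j a * f - f * affineE i j a) x =
      ∑ᶠ p : ℤ, (NO p i (p + a) j * f - f * NO p i (p + a) j) x := by
  have hfin : (Function.support fun p : ℤ => f (NO p i (p + a) j x)).Finite :=
    (finite_support_NO i j a x).subset fun p hp h => hp (by simp only at h; simp [h])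
  simp only [LinearMap.sub_apply, Module.End.mul_apply]
  rw [finsum_sub_distrib (finite_support_NO i j a (f x)) hfin, affineE_apply i j a (f x),
    affineE_apply i j a x]
  congr 1
  exact f.toAddMonoidHom.map_finsum (finite_support_NO i j a x)

theorem affineE_commutator_QF :
    affineE i j a * QF n k - QF n k * affineE i j a = if j = k then QF (n - a) i else 0 := by
  refine LinearMap.ext fun x => ?_
  simp only [affineE_commutator_apply, NO_commutator_QF]
  rw [finsum_eq_single _ (n - a) fun p hp => by rw [if_neg (by omega)]; rfl]
  simp

theorem affineE_commutator_PF :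
    affineE i j a * PF n k - PF n k * affineE i j a =
      -if i = k then PF (n + a) j else 0 := by
  refine LinearMap.ext fun x => ?_
  simp only [affineE_commutator_apply, NO_commutator_PF]
  rw [finsum_eq_single _ n fun p hp => by rw [if_neg (by omega)]; simp]
  simp [eq_comm]

theorem affineE_commutator_NO (x : Fock r) :
    (affineE i j a * NO n k (n + b) l - NO n k (n + b) l * affineE i j a) x =
      (if j = k then NO (n - a) i (n - a + (a + b)) l x else 0) -
        (if i = l then NO n k (n + (a + b)) j x else 0) +
        (if i = l ∧ j = k ∧ a = -b then
          ((if n ≤ a then 1 else 0) - (if n ≤ 0 then 1 else 0) : ℤ) • x else 0) := by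
  have hQ := affineE_commutator_QF i j k a n
  have hP := affineE_commutator_PF i j l a (n + b)
  have hleib : affineE i j a * NO n k (n + b) l - NO n k (n + b) l * affineE i j a =
      (affineE i j a * QF n k - QF n k * affineE i j a) * PF (n + b) l +
        QF n k * (affineE i j a * PF (n + b) l - PF (n + b) l * affineE i j a) := by
    rw [← sub_eq_of_eq_add (QF_mul_PF n (n + b) k l)]
    split_ifs <;> noncomm_ring
  have e₁ : n - a + (a + b) = n + b := by ring
  have e₂ : n + b + a = n + (a + b) := by ring
  rw [hleib, hQ, hP, e₁, e₂]
  have q₁ := QF_mul_PF (n - a) (n + b) i l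
  have q₂ := QF_mul_PF n (n + (a + b)) k j
  by_cases hjk : j = k <;> by_cases hil : i = l
  · subst hjk hil
    by_cases hab : a = -b
    · obtain rfl : b = -a := by omega
      have c₁ : (n + -a ≤ 0 ∧ n - a = n + -a) = (n ≤ a) := propext (by omega)
      have c₂ : (n + (a + -a) ≤ 0 ∧ n = n + (a + -a)) = (n ≤ 0) := propext (by omega)
      simp only [and_true, c₁, c₂] at q₁ q₂
      simp only [if_true, mul_neg, q₁, q₂, neg_neg, and_self]
      split_ifs <;> simp [sub_eq_add_neg, add_assoc, add_comm, add_left_comm]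
    · have c₁ : ¬(n + b ≤ 0 ∧ n - a = n + b) := by omega
      have c₂ : ¬(n + (a + b) ≤ 0 ∧ n = n + (a + b)) := by omega
      simp only [and_true, if_neg c₁, if_neg c₂] at q₁ q₂
      simp only [if_true, mul_neg, q₁, q₂]
      simp [hab, sub_eq_add_neg]
  · simp [-Module.End.mul_apply, hjk, hil, q₁]
  · simp [-Module.End.mul_apply, hjk, hil, Ne.symm hjk, q₂]
  · simp [hjk, hil]

theorem finite_support_step_sub_step :
    (Function.support fun n : ℤ =>
      ((if n ≤ a then 1 else 0) - (if n ≤ 0 then 1 else 0) : ℤ)).Finite := by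
  refine (Set.finite_Icc (min 0 a) (max 0 a)).subset fun n hn => ?_
  rw [Function.mem_support] at hn
  rw [Set.mem_Icc]
  split_ifs at hn <;> omega

theorem finsum_step_sub_step :
    ∑ᶠ n : ℤ, ((if n ≤ a then 1 else 0) - (if n ≤ 0 then 1 else 0) : ℤ) = a := by
  rcases le_total 0 a with ha | ha
  · rw [finsum_eq_sum_of_support_subset (s := Finset.Ioc 0 a) _ fun n hn => ?_,
      Finset.sum_congr rfl (g := fun _ => 1) fun n hn => ?_]
    · simp [ha]
    · rw [Finset.mem_Ioc] at hn
      split_ifs <;> omega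
    · rw [Function.mem_support] at hn
      rw [Finset.mem_coe, Finset.mem_Ioc]
      split_ifs at hn <;> omega
  · rw [finsum_eq_sum_of_support_subset (s := Finset.Ioc a 0) _ fun n hn => ?_,
      Finset.sum_congr rfl (g := fun _ => -1) fun n hn => ?_]
    · simp [ha]
    · rw [Finset.mem_Ioc] at hn
      split_ifs <;> omega
    · rw [Function.mem_support] at hn
      rw [Finset.mem_coe, Finset.mem_Ioc]
      split_ifs at hn <;> omega

theorem affineE_commutator_affineE :
    affineE i j a * affineE k l b - affineE k l b * affineE i j a =
      (if j = k then affineE i l (a + b) else 0) -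
        (if i = l then affineE k j (a + b) else 0) +
        (if i = l ∧ j = k ∧ a = -b then a • (1 : Module.End ℤ (Fock r)) else 0) := by
  refine LinearMap.ext fun x => ?_
  have h := affineE_commutator_apply k l b (affineE i j a) x
  have hsum : (affineE i j a * affineE k l b - affineE k l b * affineE i j a) x =
      ∑ᶠ n : ℤ,
        (affineE i j a * NO n k (n + b) l - NO n k (n + b) l * affineE i j a) x := by
    rw [← neg_sub, LinearMap.neg_apply, h, ← finsum_neg_distrib]
    refine finsum_congr fun n => ?_
    rw [← LinearMap.neg_apply, neg_sub]
  rw [hsum]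
  simp only [affineE_commutator_NO]
  have f₁ := (finite_support_NO i l (a + b) x).preimage
    (Equiv.subRight a).injective.injOn
  have f₂ := finite_support_NO k j (a + b) x
  have f₃ := (finite_support_step_sub_step a).subset
    (Function.support_smul_subset_left _ fun _ => x)
  have s₁ : ∑ᶠ n : ℤ, NO (n - a) i (n - a + (a + b)) l x = affineE i l (a + b) x := by
    rw [affineE_apply]
    exact finsum_comp_equiv (Equiv.subRight a)
      (f := fun n : ℤ => NO n i (n + (a + b)) l x)
  have s₃ : ∑ᶠ n : ℤ, ((if n ≤ a then 1 else 0) - (if n ≤ 0 then 1 else 0) : ℤ) • x =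
      a • x := by
    rw [← finsum_smul' (finite_support_step_sub_step a) x, finsum_step_sub_step]
  rw [finsum_add_distrib, finsum_sub_distrib]
  · split_ifs <;> simp [s₁, s₃, affineE_apply k j (a + b) x]
  · split_ifs
    · exact f₁
    · simp [Function.HasFiniteSupport]
  · split_ifs
    · exact f₂
    · simp [Function.HasFiniteSupport]
  · refine (Set.Finite.union (s := Function.support _) ?_ ?_).subset
      (Function.support_sub _ _)
    · split_ifs
      · exact f₁
      · simp
    · split_ifs
      · exact f₂
      · simp
  · split_ifs
    · exact f₃
    · simp [Function.HasFiniteSupport]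

end Commutators

/-!
Statement 10 (Boson–Fermion correspondence, affine `gl_r` relations): the sums
`e_{ij}^a = Σ_m :Q_{m,i}P_{m+a,j}:` are pointwise finite, hence define additive
endomorphisms of `𝔉(r)`; they preserve each central-charge component; and they satisfy
the commutation relations of the affine Lie algebra `gl_r` at level `1`.
-/

theorem stmt_10 {r : ℕ} (hr : 0 < r) :
    -- (a) pointwise finiteness, and `e_{ij}^a` is given by the finite sum on each basis vector
    (∀ (i j : Fin r) (a : ℤ) (m : MayaDiagram r),
      {k : ℤ | NO k i (k + a) j (Finsupp.single m 1) ≠ 0}.Finite) ∧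
    (∀ (i j : Fin r) (a : ℤ) (m : MayaDiagram r),
      affineE i j a (Finsupp.single m 1) =
        ∑ᶠ k : ℤ, NO k i (k + a) j (Finsupp.single m 1)) ∧
    -- (b) each `e_{ij}^a` preserves every central-charge component
    (∀ (i j : Fin r) (a : ℤ) (l : ℤ) (x : Fock r),
      x ∈ FockCharge r l → affineE i j a x ∈ FockCharge r l) ∧
    -- (c) the affine `gl_r` commutation relations
    (∀ (i j k l : Fin r) (a b : ℤ),
      affineE i j a * affineE k l b - affineE k l b * affineE i j a =
        (if j = k then affineE i l (a + b) else 0) -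
          (if i = l then affineE k j (a + b) else 0) +
          (if i = l ∧ j = k ∧ a = -b then a • (1 : Module.End ℤ (Fock r)) else 0)) := by
  exact ⟨finite_support_NO_single, affineE_single,
    fun i j a l x hx => affineE_mem_FockCharge i j a hx, affineE_commutator_affineE⟩
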